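/- Suppose the probability density p satisfies p(y) ≤ p_max < ∞ for all y ∈ ℝ^d, and the measurable kernel k satisfies 0 ≤ k(r) ≤ 1 for all r ∈ ℝ and ∫_{ℝ^d} k(‖u‖₂)² du < ∞; set c₁ = p_max ∫_{ℝ^d} k(‖u‖₂)² du. Let h > 0, n ≥ 1, and δ ∈ (0, 1) be such that √(4 c₁ log(2/δ) / (n h^d)) ≤ 3c₁. Then for every x ∈ ℝ^d, P(|p̂(x) − E[p̂(x)]| > √(4 c₁ log(2/δ) / (n h^d))) ≤ δ. -/

import Mathlib

open MeasureTheory ProbabilityTheory Real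

set_option autoImplicit false

/-- Kernel density estimator at `x` built from sample points `X` with kernel `k`
and bandwidth `h`. -/
noncomputable def kde {d : ℕ} (n : ℕ) (k : ℝ → ℝ) (h : ℝ)
    (X : Fin n → EuclideanSpace ℝ (Fin d)) (x : EuclideanSpace ℝ (Fin d)) : ℝ :=
  (1 / (n : ℝ)) * ∑ i, (1 / h ^ d) * k (‖x - X i‖ / h)

/-- The law of `n` i.i.d. samples in `ℝ^d` drawn from the density `p`:
the `n`-fold product of the measure with density `p` w.r.t. Lebesgue measure. -/
noncomputable def sampleMeasure {d : ℕ} (n : ℕ) (p : EuclideanSpace ℝ (Fin d) → ℝ) :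
    Measure (Fin n → EuclideanSpace ℝ (Fin d)) :=
  Measure.pi fun _ => MeasureTheory.volume.withDensity fun y => ENNReal.ofReal (p y)
theorem exp_le_one_add_add_sq {z : ℝ} (hz : z ≤ 3 / 2) : exp z ≤ 1 + z + z ^ 2 := by
  rcases le_total z (-1) with h1 | h1
  · have : exp z ≤ 1 := exp_le_one_iff.2 (by linarith)
    nlinarith
  rcases le_total z 1 with h2 | h2
  · have := (abs_le.1 (abs_exp_sub_one_sub_id_le (abs_le.2 ⟨h1, h2⟩))).2
    linarith
  · obtain ⟨w, rfl⟩ : ∃ w, z = 1 + w := ⟨z - 1, by ring⟩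
    have hw0 : 0 ≤ w := by linarith
    have hw1 : w ≤ 1 / 2 := by linarith
    have hw := exp_bound' hw0 (by linarith) (n := 3) (by norm_num)
    norm_num [Finset.sum_range_succ, Nat.factorial] at hw
    have hw' : exp w ≤ 1 + w + 11 / 18 * w ^ 2 := by
      nlinarith [mul_nonneg (sq_nonneg w) (sub_nonneg.2 hw1)]
    calc exp (1 + w) = exp 1 * exp w := exp_add _ _
      _ ≤ 2.7182818286 * (1 + w + 11 / 18 * w ^ 2) := by
          gcongr
          exact exp_one_lt_d9.le
      _ ≤ _ := by nlinarith

section SampleMean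

variable {E : Type*} [MeasurableSpace E] {μ : Measure E} [IsProbabilityMeasure μ] {g : E → ℝ}
  {b : ℝ}

theorem integrable_of_nonneg_of_le (hg : Measurable g) (hg0 : ∀ y, 0 ≤ g y)
    (hgb : ∀ y, g y ≤ b) : Integrable g μ :=
  Integrable.of_mem_Icc 0 b hg.aemeasurable (ae_of_all _ fun y => ⟨hg0 y, hgb y⟩)

theorem abs_sub_integral_le (hg : Measurable g) (hg0 : ∀ y, 0 ≤ g y)
    (hgb : ∀ y, g y ≤ b) (y : E) : |g y - ∫ z, g z ∂μ| ≤ b := by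
  have h0 : 0 ≤ ∫ z, g z ∂μ := integral_nonneg hg0
  have h1 : ∫ z, g z ∂μ ≤ b := by
    simpa using integral_mono (integrable_of_nonneg_of_le (μ := μ) hg hg0 hgb)
      (integrable_const b) hgb
  rw [abs_le]
  constructor <;> linarith [hg0 y, hgb y]

theorem mgf_sub_integral_le (hg : Measurable g) (hg0 : ∀ y, 0 ≤ g y) (hgb : ∀ y, g y ≤ b)
    {t : ℝ} (ht : |t| * b ≤ 3 / 2) :
    mgf (fun y => g y - ∫ z, g z ∂μ) μ t ≤ exp (t ^ 2 * Var[g; μ]) := by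
  have hgi := integrable_of_nonneg_of_le (μ := μ) hg hg0 hgb
  have hb := abs_sub_integral_le (μ := μ) hg hg0 hgb
  set m := ∫ z, g z ∂μ
  have hZi : Integrable (fun y => g y - m) μ := hgi.sub (integrable_const m)
  have hZ2 : Integrable (fun y => (g y - m) ^ 2) μ := by
    refine Integrable.of_mem_Icc 0 (b ^ 2) (by fun_prop) (ae_of_all _ fun y => ⟨sq_nonneg _, ?_⟩)
    exact sq_le_sq.2 ((hb y).trans (le_abs_self b))
  have hle (y : E) : exp (t * (g y - m)) ≤ 1 + t * (g y - m) + t ^ 2 * (g y - m) ^ 2 := by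
    rw [← mul_pow]
    refine exp_le_one_add_add_sq (((le_abs_self _).trans ?_).trans ht)
    rw [abs_mul]
    gcongr
    exact hb y
  calc mgf (fun y => g y - m) μ t
      ≤ ∫ y, (1 + t * (g y - m) + t ^ 2 * (g y - m) ^ 2) ∂μ :=
        integral_mono_of_nonneg (ae_of_all _ fun y => (exp_pos _).le)
          (((integrable_const 1).add (hZi.const_mul t)).add (hZ2.const_mul _)) (ae_of_all _ hle)
    _ = 1 + t ^ 2 * Var[g; μ] := by
        have hlin : Integrable (fun y => 1 + t * (g y - m)) μ :=
          (integrable_const 1).add (hZi.const_mul t)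
        rw [integral_add hlin (hZ2.const_mul _), integral_add (integrable_const 1) (hZi.const_mul t), integral_const_mul,
          integral_const_mul, integral_sub hgi (integrable_const m),
          variance_eq_integral hg.aemeasurable]
        simp [m]
    _ ≤ _ := by linarith [add_one_le_exp (t ^ 2 * Var[g; μ])]

theorem sampleMean_deviation_le (hg : Measurable g) (hg0 : ∀ y, 0 ≤ g y) (hgb : ∀ y, g y ≤ b)
    {V ε : ℝ} (hV0 : 0 < V) (hV : Var[g; μ] ≤ V) (hε : 0 ≤ ε) (hεb : ε * b ≤ 3 * V)
    {n : ℕ} (hn : 1 ≤ n) :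
    (Measure.pi fun _ : Fin n => μ).real
        {X | ε < |1 / (n : ℝ) * ∑ i, g (X i) - ∫ z, g z ∂μ|} ≤
      2 * exp (-(n * ε ^ 2 / (4 * V))) := by
  have hb := abs_sub_integral_le (μ := μ) hg hg0 hgb
  have hmgf (t : ℝ) (ht : |t| * b ≤ 3 / 2) := mgf_sub_integral_le (μ := μ) hg hg0 hgb ht
  set m := ∫ z, g z ∂μ
  set P := Measure.pi fun _ : Fin n => μ
  set S : (Fin n → E) → ℝ := ∑ i, fun X => g (X i) - m with hS
  have hn0 : (0 : ℝ) < n := by exact_mod_cast hn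
  have hmean (X : Fin n → E) : 1 / (n : ℝ) * ∑ i, g (X i) - m = S X / n := by
    simp only [hS, Finset.sum_apply, Finset.sum_sub_distrib, Finset.sum_const, Finset.card_univ,
      Fintype.card_fin, nsmul_eq_mul]
    field_simp
  have hind : iIndepFun (fun (i : Fin n) (X : Fin n → E) => g (X i) - m) P :=
    iIndepFun_pi (X := fun _ y => g y - m) fun _ => by fun_prop
  have hSmgf (t : ℝ) (ht : |t| * b ≤ 3 / 2) : mgf S P t ≤ exp (n * (t ^ 2 * V)) := by
    have hcoord (i : Fin n) : mgf (fun X : Fin n → E => g (X i) - m) P t =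
        mgf (fun y => g y - m) μ t :=
      integral_comp_eval (μ := fun _ : Fin n => μ) (i := i) (f := fun y => exp (t * (g y - m)))
        (by fun_prop)
    rw [hS, hind.mgf_sum fun i => by fun_prop, Finset.prod_congr rfl fun i _ => hcoord i,
      Finset.prod_const, Finset.card_univ, Fintype.card_fin, exp_nat_mul]
    refine pow_le_pow_left₀ mgf_nonneg ((hmgf t ht).trans ?_) n
    gcongr
  have hSint (t : ℝ) : Integrable (fun X => exp (t * S X)) P := by
    have hSm : Measurable S := by fun_prop
    refine Integrable.of_mem_Icc 0 (exp (|t| * (n * b))) (by fun_prop)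
      (ae_of_all _ fun X => ⟨(exp_pos _).le, exp_le_exp.2 ?_⟩)
    refine (le_abs_self _).trans ?_
    rw [abs_mul]
    gcongr
    rw [hS, Finset.sum_apply]
    refine (Finset.abs_sum_le_sum_abs _ _).trans ((Finset.sum_le_card_nsmul _ _ b
      fun i _ => hb (X i)).trans ?_)
    simp
  set t := ε / (2 * V) with ht
  have ht0 : 0 ≤ t := by positivity
  have htb : |t| * b ≤ 3 / 2 := by
    rw [abs_of_nonneg ht0, ht, div_mul_eq_mul_div, div_le_iff₀ (by positivity)]
    linarith
  have hexp : exp (-t * (n * ε)) * exp (n * (t ^ 2 * V)) = exp (-(n * ε ^ 2 / (4 * V))) := by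
    rw [← exp_add, ht]
    congr 1
    field_simp
    ring
  have hup : P.real {X | n * ε ≤ S X} ≤ exp (-(n * ε ^ 2 / (4 * V))) :=
    (measure_ge_le_exp_mul_mgf _ ht0 (hSint t)).trans
      ((mul_le_mul_of_nonneg_left (hSmgf t htb) (exp_pos _).le).trans_eq hexp)
  have hlow : P.real {X | S X ≤ -(n * ε)} ≤ exp (-(n * ε ^ 2 / (4 * V))) := by
    refine (measure_le_le_exp_mul_mgf _ (neg_nonpos.2 ht0) (hSint (-t))).trans
      ((mul_le_mul_of_nonneg_left (hSmgf (-t) (by rwa [abs_neg])) (exp_pos _).le).trans_eq ?_)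
    rw [← hexp, neg_sq, mul_neg, neg_mul_comm, neg_mul_neg, neg_mul]
  have hsub : {X : Fin n → E | ε < |1 / (n : ℝ) * ∑ i, g (X i) - m|} ⊆
      {X | n * ε ≤ S X} ∪ {X | S X ≤ -(n * ε)} := by
    intro X hX
    rw [Set.mem_ofPred_eq, hmean, lt_abs] at hX
    rcases hX with hX | hX
    · left
      rw [lt_div_iff₀ hn0] at hX
      exact (mul_comm _ _).trans_le hX.le
    · right
      rw [← neg_div, lt_div_iff₀ hn0] at hX
      simp only [Set.mem_ofPred_eq]
      linarith
  linarith [measureReal_mono (μ := P) hsub,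
    measureReal_union_le (μ := P) {X | n * ε ≤ S X} {X | S X ≤ -(n * ε)}]

theorem sampleMean_ae_eq_integral (hg : MemLp g 2 μ) (hV : Var[g; μ] ≤ 0) {n : ℕ} (hn : 1 ≤ n) :
    ∀ᵐ X ∂(Measure.pi fun _ : Fin n => μ), 1 / (n : ℝ) * ∑ i, g (X i) = ∫ z, g z ∂μ := by
  have hconst : ∀ᵐ y ∂μ, g y = ∫ z, g z ∂μ :=
    ae_eq_integral_of_variance_eq_zero hg (le_antisymm hV (variance_nonneg _ _))
  have hall : ∀ᵐ X ∂(Measure.pi fun _ : Fin n => μ), ∀ i, g (X i) = ∫ z, g z ∂μ :=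
    ae_all_iff.2 fun i => (Measure.tendsto_eval_ae_ae (μ := fun _ : Fin n => μ) (i := i)).eventually hconst
  filter_upwards [hall] with X hX
  have hn0 : (n : ℝ) ≠ 0 := by positivity
  simp [hX, hn0]

theorem integral_sampleMean (hg : Integrable g μ) {n : ℕ} (hn : 1 ≤ n) :
    ∫ X, 1 / (n : ℝ) * ∑ i, g (X i) ∂(Measure.pi fun _ : Fin n => μ) = ∫ z, g z ∂μ := by
  have hn0 : (n : ℝ) ≠ 0 := by positivity
  rw [integral_const_mul, integral_finsetSum _ fun i _ => integrable_comp_eval hg,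
    Finset.sum_congr rfl fun i _ => integral_comp_eval (μ := fun _ : Fin n => μ) (i := i)
      hg.aestronglyMeasurable]
  simp [hn0]

end SampleMean

section Density

variable {E : Type*} [MeasurableSpace E] {ν : Measure E} {p f : E → ℝ}

theorem isProbabilityMeasure_withDensity_ofReal (hp_nonneg : ∀ y, 0 ≤ p y)
    (hp_density : ∫ y, p y ∂ν = 1) :
    IsProbabilityMeasure (ν.withDensity fun y => ENNReal.ofReal (p y)) := by
  have hpi : Integrable p ν := .of_integral_ne_zero (by simp [hp_density])
  constructor
  rw [withDensity_apply _ .univ, Measure.restrict_univ,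
    ← ofReal_integral_eq_lintegral_ofReal hpi (ae_of_all _ hp_nonneg), hp_density,
    ENNReal.ofReal_one]

theorem integral_withDensity_ofReal_le {pmax : ℝ} (hp_meas : Measurable p)
    (hp_nonneg : ∀ y, 0 ≤ p y) (hp_le : ∀ y, p y ≤ pmax) (hf : Integrable f ν)
    (hf0 : ∀ y, 0 ≤ f y) :
    ∫ y, f y ∂(ν.withDensity fun y => ENNReal.ofReal (p y)) ≤ pmax * ∫ y, f y ∂ν := by
  rw [integral_withDensity_eq_integral_toReal_smul hp_meas.ennreal_ofReal
    (ae_of_all _ fun y => ENNReal.ofReal_lt_top), ← integral_const_mul]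
  refine integral_mono_of_nonneg (ae_of_all _ fun y => by have := hf0 y; positivity)
    (hf.const_mul _) (ae_of_all _ fun y => ?_)
  simp only [ENNReal.toReal_ofReal (hp_nonneg y), smul_eq_mul]
  exact mul_le_mul_of_nonneg_right (hp_le y) (hf0 y)

end Density

section Rescaling

variable {d : ℕ} {f : ℝ → ℝ} {h : ℝ}

theorem integrable_comp_norm_sub_div (hf : Integrable fun u : EuclideanSpace ℝ (Fin d) => f ‖u‖)
    (hh : 0 < h) (x : EuclideanSpace ℝ (Fin d)) :
    Integrable fun y : EuclideanSpace ℝ (Fin d) => f (‖x - y‖ / h) := by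
  have := (hf.comp_smul (inv_ne_zero hh.ne')).comp_sub_left x
  simpa [norm_smul, abs_of_pos hh, div_eq_inv_mul] using this

theorem integral_comp_norm_sub_div (hh : 0 < h) (x : EuclideanSpace ℝ (Fin d)) :
    ∫ y : EuclideanSpace ℝ (Fin d), f (‖x - y‖ / h) =
      h ^ d * ∫ u : EuclideanSpace ℝ (Fin d), f ‖u‖ := by
  rw [integral_sub_left_eq_self (fun u : EuclideanSpace ℝ (Fin d) => f (‖u‖ / h)) volume x]
  have := Measure.integral_comp_inv_smul_of_nonneg (volume : Measure (EuclideanSpace ℝ (Fin d)))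
    (fun u => f ‖u‖) hh.le
  simpa [norm_smul, abs_of_pos hh, div_eq_inv_mul] using this

end Rescaling

/-- High-probability deviation bound for the kernel density estimator:
with `c₁ = p_max ∫ k(‖u‖)² du` and `δ ∈ (0,1)` such that
`√(4c₁ log(2/δ)/(n h^d)) ≤ 3c₁`, we have
`P(|p̂(x) − E[p̂(x)]| > √(4c₁ log(2/δ)/(n h^d))) ≤ δ`. -/
theorem kde_deviation_bound {d : ℕ} (hd : 1 ≤ d)
    (p : EuclideanSpace ℝ (Fin d) → ℝ) (pmax : ℝ)
    (hp_meas : Measurable p)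
    (hp_nonneg : ∀ y, 0 ≤ p y) (hp_le : ∀ y, p y ≤ pmax)
    (hp_density : (∫ y, p y) = 1)
    (k : ℝ → ℝ) (hk_meas : Measurable k)
    (hk_nonneg : ∀ r, 0 ≤ k r) (hk_le_one : ∀ r, k r ≤ 1)
    (hk2 : Integrable fun u : EuclideanSpace ℝ (Fin d) => (k ‖u‖) ^ 2)
    (h : ℝ) (hh : 0 < h) (n : ℕ) (hn : 1 ≤ n)
    (δ : ℝ) (hδ0 : 0 < δ) (hδ1 : δ < 1)
    (hsmall : Real.sqrt (4 * (pmax * ∫ u : EuclideanSpace ℝ (Fin d), (k ‖u‖) ^ 2) *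
          Real.log (2 / δ) / (n * h ^ d)) ≤
        3 * (pmax * ∫ u : EuclideanSpace ℝ (Fin d), (k ‖u‖) ^ 2))
    (x : EuclideanSpace ℝ (Fin d)) :
    sampleMeasure n p
        {X | |kde n k h X x - ∫ X', kde n k h X' x ∂sampleMeasure n p| >
          Real.sqrt (4 * (pmax * ∫ u : EuclideanSpace ℝ (Fin d), (k ‖u‖) ^ 2) *
            Real.log (2 / δ) / (n * h ^ d))} ≤
      ENNReal.ofReal δ := by
  set μ : Measure (EuclideanSpace ℝ (Fin d)) :=
    volume.withDensity fun y => ENNReal.ofReal (p y) with hμ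
  have : IsProbabilityMeasure μ := isProbabilityMeasure_withDensity_ofReal hp_nonneg hp_density
  set c := pmax * ∫ u : EuclideanSpace ℝ (Fin d), (k ‖u‖) ^ 2 with hc
  set ε := √(4 * c * Real.log (2 / δ) / (n * h ^ d)) with hε
  set g : EuclideanSpace ℝ (Fin d) → ℝ := fun y => 1 / h ^ d * k (‖x - y‖ / h) with hg
  have hgm : Measurable g := by fun_prop
  have hhd : 0 < h ^ d := by positivity
  have hg0 (y) : 0 ≤ g y := mul_nonneg (by positivity) (hk_nonneg _)
  have hgb (y) : g y ≤ 1 / h ^ d := mul_le_of_le_one_right (by positivity) (hk_le_one _)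
  have hgL2 : MemLp g 2 μ := by
    refine MemLp.of_bound hgm.aestronglyMeasurable (1 / h ^ d) (ae_of_all _ fun y => ?_)
    rw [norm_of_nonneg (hg0 y)]
    exact hgb y
  have hVar : Var[g; μ] ≤ c / h ^ d := by
    have hscaled : ∫ y, (g y) ^ 2 = (∫ u : EuclideanSpace ℝ (Fin d), (k ‖u‖) ^ 2) / h ^ d := by
      simp only [hg, mul_pow]
      rw [integral_const_mul, integral_comp_norm_sub_div (f := fun r => k r ^ 2) hh]
      field_simp
    have hgi : Integrable fun y => (g y) ^ 2 := by
      simp only [hg, mul_pow]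
      exact (integrable_comp_norm_sub_div (f := fun r => k r ^ 2) hk2 hh x).const_mul _
    calc Var[g; μ] ≤ ∫ y, (g y) ^ 2 ∂μ := variance_le_expectation_sq hgm.aestronglyMeasurable
      _ ≤ pmax * ∫ y, (g y) ^ 2 :=
        integral_withDensity_ofReal_le hp_meas hp_nonneg hp_le hgi fun y => sq_nonneg _
      _ = c / h ^ d := by rw [hscaled, hc, mul_div_assoc]
  have hmean : ∫ X', kde n k h X' x ∂sampleMeasure n p = ∫ z, g z ∂μ :=
    integral_sampleMean (hgL2.integrable one_le_two) hn
  rw [hmean]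
  have hc0 : 0 ≤ c := mul_nonneg ((hp_nonneg x).trans (hp_le x))
    (integral_nonneg fun u => sq_nonneg _)
  rcases hc0.eq_or_lt with hc0 | hc0
  · have hzero : sampleMeasure n p {X | |kde n k h X x - ∫ z, g z ∂μ| > ε} = 0 := by
      refine measure_mono_null ?_ (ae_iff.1 (sampleMean_ae_eq_integral hgL2
        (by simpa [← hc0] using hVar) hn))
      intro X hX heq
      have hkde : kde n k h X x = ∫ z, g z ∂μ := heq
      rw [Set.mem_ofPred_eq, hkde, sub_self, abs_zero] at hX
      exact hX.not_ge (sqrt_nonneg _)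
    rw [hzero]
    exact zero_le
  · have hn0 : (0 : ℝ) < n := by exact_mod_cast hn
    have hlog : 0 ≤ Real.log (2 / δ) := log_nonneg (by rw [le_div_iff₀ hδ0]; linarith)
    have hεsq : ε ^ 2 = 4 * c * Real.log (2 / δ) / (n * h ^ d) := sq_sqrt (by positivity)
    have hdev := sampleMean_deviation_le hgm hg0 hgb (div_pos hc0 hhd) hVar (sqrt_nonneg _)
      (ε := ε) (by rw [mul_one_div, ← mul_div_assoc]; gcongr) hn
    have hval : 2 * exp (-(n * ε ^ 2 / (4 * (c / h ^ d)))) = δ := by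
      have : n * ε ^ 2 / (4 * (c / h ^ d)) = Real.log (2 / δ) := by
        rw [hεsq]
        field_simp
      rw [this, ← log_inv, exp_log (by positivity)]
      field_simp
    rw [hval] at hdev
    have : IsProbabilityMeasure (sampleMeasure n p) :=
      inferInstanceAs (IsProbabilityMeasure (Measure.pi fun _ : Fin n => μ))
    exact (ENNReal.le_ofReal_iff_toReal_le (measure_ne_top _ _) hδ0.le).2 hdev
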